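/- Let d ≥ 3, s ∈ {0,1}^d, let f be a generator, and define C_f^s(u) := ∫_{[0,u]} c_f^s(v) dv for u ∈ [0,1]^d. Then for every pair (j,k) ∈ {1,…,d}², the second-order partial derivative ∂²C_f^s/(∂u_j ∂u_k) exists and is continuous on the set V_j ∩ V_k, where V_l := {u ∈ [0,1]^d : 0 < u_l < 1}, and satisfies |∂²C_f^s/(∂u_j ∂u_k)(u)| ≤ 1 there; moreover, for j ≠ k it is given by ∫_{[0, u_{−{j,k}}]} c_f^s(u_j, u_k, v_{−{j,k}}) dv_{−{j,k}} and lies in [0,1]. -/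

import Mathlib

open MeasureTheory

/-- A generator: a probability density on `[0,1]`. -/
def IsGenerator (f : ℝ → ℝ) : Prop :=
  Measurable f ∧ (∀ x ∈ Set.Icc (0:ℝ) 1, 0 ≤ f x) ∧ ∫ x in Set.Icc (0:ℝ) 1, f x = 1

section

open Set Filter Topology

/-- The properties of the periodic extension of a generator that the proof uses. -/
structure PeriodicDensity (g : ℝ → ℝ) : Prop where
  measurable : Measurable g
  nonneg : ∀ x, 0 ≤ g x
  periodic : Function.Periodic g 1
  intervalIntegrable : ∀ a b, IntervalIntegrable g volume a b
  integral_eq_one : ∫ x in (0:ℝ)..1, g x = 1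

theorem IsGenerator.periodicDensity {f : ℝ → ℝ} (hf : IsGenerator f) :
    PeriodicDensity fun t => f (Int.fract t) := by
  obtain ⟨hm, h0, h1⟩ := hf
  have hper : Function.Periodic (fun t => f (Int.fract t)) 1 := fun t => by
    simp only [Int.fract_add_one]
  have hint : IntegrableOn f (Icc 0 1) := by
    by_contra h
    rw [integral_undef h] at h1
    exact zero_ne_one h1
  have hEq : EqOn f (fun t => f (Int.fract t)) (Ioo 0 1) := fun t ht => by
    simp only [Int.fract_eq_self.2 ⟨ht.1.le, ht.2⟩]
  have hint' : IntervalIntegrable (fun t => f (Int.fract t)) volume 0 1 := by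
    rw [intervalIntegrable_iff_integrableOn_Ioo_of_le zero_le_one]
    exact (hint.mono_set Ioo_subset_Icc_self).congr_fun hEq measurableSet_Ioo
  refine ⟨hm.comp measurable_fract, fun x => h0 _ ⟨Int.fract_nonneg x, (Int.fract_lt_one x).le⟩,
    hper, hper.intervalIntegrable₀ one_ne_zero hint', ?_⟩
  rw [intervalIntegral.integral_of_le zero_le_one, integral_Ioc_eq_integral_Ioo,
    ← setIntegral_congr_fun measurableSet_Ioo hEq, ← integral_Icc_eq_integral_Ioo, h1]

/-- For a list of pairs `(e₁, b₁), …, (eₙ, bₙ)`, the iterated integral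
`∫_0^{b₁} ⋯ ∫_0^{bₙ} g (t + e₁ x₁ + ⋯ + eₙ xₙ) dxₙ ⋯ dx₁`. -/
noncomputable def iterInt (g : ℝ → ℝ) : List (ℝ × ℝ) → ℝ → ℝ
  | [], t => g t
  | p :: L, t => ∫ x in (0:ℝ)..p.2, iterInt g L (t + p.1 * x)

theorem integral_comp_add_mul_eq_sub {h : ℝ → ℝ} (hh : ∀ a b, IntervalIntegrable h volume a b)
    {e : ℝ} (he : e ≠ 0) (t b : ℝ) :
    ∫ x in (0:ℝ)..b, h (t + e * x)
      = e⁻¹ * ((∫ y in (0:ℝ)..(t + e * b), h y) - ∫ y in (0:ℝ)..t, h y) := by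
  rw [intervalIntegral.integral_comp_add_mul h he,
    intervalIntegral.integral_interval_sub_left (hh _ _) (hh _ _)]
  simp

section iterInt

variable {g : ℝ → ℝ} {ι : Type*} {e : ι → ℝ}

theorem iterInt_intervalIntegrable (hg : PeriodicDensity g) :
    ∀ L : List (ℝ × ℝ), (∀ p ∈ L, p.1 ≠ 0) →
      (∀ a b, IntervalIntegrable (iterInt g L) volume a b) ∧ (L ≠ [] → Continuous (iterInt g L))
  | [], _ => ⟨hg.intervalIntegrable, fun h => absurd rfl h⟩
  | p :: L, h => by
    have ih := (iterInt_intervalIntegrable hg L fun q hq => h q (List.mem_cons_of_mem _ hq)).1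
    have hc : Continuous (iterInt g (p :: L)) := by
      have : iterInt g (p :: L) = fun t => p.1⁻¹ * ((∫ y in (0:ℝ)..(t + p.1 * p.2), iterInt g L y)
          - ∫ y in (0:ℝ)..t, iterInt g L y) :=
        funext fun t => integral_comp_add_mul_eq_sub ih (h p List.mem_cons_self) t p.2
      rw [this]
      have hG := intervalIntegral.continuous_primitive ih 0
      exact continuous_const.mul ((hG.comp (by fun_prop)).sub hG)
    exact ⟨hc.intervalIntegrable, fun _ => hc⟩

theorem iterInt_comp_intervalIntegrable (hg : PeriodicDensity g) {L : List (ℝ × ℝ)}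
    (hL : ∀ p ∈ L, p.1 ≠ 0) {e : ℝ} (he : e ≠ 0) (t a b : ℝ) :
    IntervalIntegrable (fun x => iterInt g L (t + e * x)) volume a b := by
  have h := (iterInt_intervalIntegrable hg L hL).1 (t + e * a) (t + e * b)
  have := (h.comp_add_left t).comp_mul_left (c := e)
  simpa [he] using this

theorem iterInt_nonneg (hg : PeriodicDensity g) :
    ∀ L : List (ℝ × ℝ), (∀ p ∈ L, 0 ≤ p.2) → ∀ t, 0 ≤ iterInt g L t
  | [], _, _ => hg.nonneg _
  | p :: L, h, _ => intervalIntegral.integral_nonneg (h p List.mem_cons_self) fun _ _ =>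
      iterInt_nonneg hg L (fun q hq => h q (List.mem_cons_of_mem _ hq)) _

theorem PeriodicDensity.integral_comp_le_one (hg : PeriodicDensity g) {e b : ℝ}
    (he : e = 1 ∨ e = -1) (hb : b ∈ Icc (0:ℝ) 1) (t : ℝ) :
    ∫ x in (0:ℝ)..b, g (t + e * x) ≤ 1 := by
  have he0 : e ≠ 0 := by rcases he with rfl | rfl <;> norm_num
  have hint := iterInt_comp_intervalIntegrable hg (L := []) (by simp) he0 t
  have h1 : ∫ x in (0:ℝ)..1, g (t + e * x) = 1 := by
    have hp := hg.periodic.intervalIntegral_add_eq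
    rw [intervalIntegral.integral_comp_add_mul g he0]
    rcases he with rfl | rfl
    · have := hp t 0
      simp only [zero_add, hg.integral_eq_one] at this
      simpa using this
    · have := hp (t - 1) 0
      simp only [zero_add, hg.integral_eq_one, sub_add_cancel] at this
      rw [intervalIntegral.integral_symm]
      simpa [sub_eq_add_neg, inv_neg] using this
  rw [← h1]
  exact intervalIntegral.integral_mono_interval le_rfl hb.1 hb.2
    (Eventually.of_forall fun x => hg.nonneg _) (hint 0 1)

theorem iterInt_le_one (hg : PeriodicDensity g) :
    ∀ L : List (ℝ × ℝ), L ≠ [] → (∀ p ∈ L, (p.1 = 1 ∨ p.1 = -1) ∧ p.2 ∈ Icc (0:ℝ) 1) →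
      ∀ t, iterInt g L t ≤ 1
  | [], h, _, _ => absurd rfl h
  | [p], _, h, t => hg.integral_comp_le_one (h p List.mem_cons_self).1 (h p List.mem_cons_self).2 t
  | p :: q :: L, _, h, t => by
    have hne : ∀ r ∈ p :: q :: L, r.1 ≠ 0 := fun r hr => by
      rcases (h r hr).1 with h | h <;> simp [h]
    have ih := iterInt_le_one hg (q :: L) (by simp) fun r hr => h r (List.mem_cons_of_mem _ hr)
    obtain ⟨hp0, hp1⟩ := (h p List.mem_cons_self).2
    calc iterInt g (p :: q :: L) t ≤ ∫ x in (0:ℝ)..p.2, (1:ℝ) :=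
          intervalIntegral.integral_mono_on hp0
            (iterInt_comp_intervalIntegrable hg (fun r hr => hne r (List.mem_cons_of_mem _ hr))
              (hne p List.mem_cons_self) t 0 p.2)
            (by simp) fun x _ => ih _
      _ ≤ 1 := by simpa using hp1

theorem continuous_iterInt (hg : PeriodicDensity g) (he : ∀ i, e i ≠ 0) :
    ∀ L : List ι, L ≠ [] →
      Continuous fun q : (ι → ℝ) × ℝ => iterInt g (L.map fun i => (e i, q.1 i)) q.2
  | [], h => absurd rfl h
  | [i], _ => by
    have : (fun q : (ι → ℝ) × ℝ => iterInt g ([i].map fun i => (e i, q.1 i)) q.2)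
        = fun q => (e i)⁻¹ * ((∫ y in (0:ℝ)..(q.2 + e i * q.1 i), g y) - ∫ y in (0:ℝ)..q.2, g y) :=
      funext fun q => integral_comp_add_mul_eq_sub hg.intervalIntegrable (he i) q.2 (q.1 i)
    rw [this]
    have hG := intervalIntegral.continuous_primitive hg.intervalIntegrable 0
    exact continuous_const.mul ((hG.comp (by fun_prop)).sub (hG.comp (by fun_prop)))
  | i :: j :: L, _ => by
    have ih := continuous_iterInt hg he (j :: L) (by simp)
    refine intervalIntegral.continuous_parametric_intervalIntegral_of_continuous (a₀ := 0)
      (f := fun (q : (ι → ℝ) × ℝ) x =>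
        iterInt g ((j :: L).map fun i => (e i, q.1 i)) (q.2 + e i * x)) (s := fun q => q.1 i)
      (ih.comp (g := fun q : (ι → ℝ) × ℝ => iterInt g ((j :: L).map fun i => (e i, q.1 i)) q.2)
        (f := fun r : ((ι → ℝ) × ℝ) × ℝ => (r.1.1, r.1.2 + e i * r.2)) (by fun_prop))
      (by fun_prop)

theorem hasDerivAt_iterInt_bound (hg : PeriodicDensity g) {L : List (ℝ × ℝ)} (hne : L ≠ [])
    (hL : ∀ p ∈ L, p.1 ≠ 0) (e t b : ℝ) :
    HasDerivAt (fun b => iterInt g ((e, b) :: L) t) (iterInt g L (t + e * b)) b :=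
  (Continuous.integral_hasStrictDerivAt
    (((iterInt_intervalIntegrable hg L hL).2 hne).comp
      (f := fun x : ℝ => t + e * x) (by fun_prop)) 0 b).hasDerivAt

theorem hasDerivAt_iterInt (hg : PeriodicDensity g) {L : List (ℝ × ℝ)} (hne : L ≠ [])
    (hL : ∀ p ∈ L, p.1 ≠ 0) {e : ℝ} (he : e ≠ 0) (b t : ℝ) :
    HasDerivAt (iterInt g ((e, b) :: L)) (e⁻¹ * (iterInt g L (t + e * b) - iterInt g L t)) t := by
  obtain ⟨hint, hcont⟩ := iterInt_intervalIntegrable hg L hL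
  have hG : ∀ y, HasDerivAt (fun y => ∫ x in (0:ℝ)..y, iterInt g L x) (iterInt g L y) y :=
    fun y => ((hcont hne).integral_hasStrictDerivAt 0 y).hasDerivAt
  have : iterInt g ((e, b) :: L) = fun t => e⁻¹ * ((∫ y in (0:ℝ)..(t + e * b), iterInt g L y)
      - ∫ y in (0:ℝ)..t, iterInt g L y) :=
    funext fun t => integral_comp_add_mul_eq_sub hint he t b
  rw [this]
  exact (((hG (t + e * b)).comp_add_const t (e * b)).sub (hG t)).const_mul _

theorem lmarginal_eq_iterInt [Fintype ι] [DecidableEq ι] (hg : PeriodicDensity g)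
    (he : ∀ i, e i ≠ 0) {b : ι → ℝ} (hb : ∀ i, 0 ≤ b i) (t : ℝ) :
    ∀ (L : List ι), L.Nodup → ∀ x : ι → ℝ,
      lmarginal (fun i => (volume : Measure ℝ).restrict (Icc 0 (b i))) L.toFinset
        (fun v => ENNReal.ofReal (g (t + ∑ i, e i * v i))) x
      = ENNReal.ofReal (iterInt g (L.map fun i => (e i, b i))
          (t + ∑ i ∈ (L.toFinset)ᶜ, e i * x i))
  | [], _, x => by simp [iterInt]
  | i :: L, hnd, x => by
    obtain ⟨hi, hnd⟩ := List.nodup_cons.1 hnd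
    have hi' : i ∉ L.toFinset := by simpa using hi
    have hmeas : Measurable fun v : ι → ℝ => ENNReal.ofReal (g (t + ∑ i, e i * v i)) :=
      (hg.measurable.comp (by fun_prop)).ennreal_ofReal
    have hsum : ∀ y, t + ∑ l ∈ (L.toFinset)ᶜ, e l * Function.update x i y l
        = t + ∑ l ∈ ((i :: L).toFinset)ᶜ, e l * x l + e i * y := fun y => by
      have : (L.toFinset)ᶜ = insert i ((i :: L).toFinset)ᶜ := by
        ext l
        by_cases h : l = i <;> simp_all
      rw [this, Finset.sum_insert (by simp), Function.update_self, add_comm (e i * y), ← add_assoc]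
      congr 2
      refine Finset.sum_congr rfl fun l hl => ?_
      rw [Function.update_of_ne]
      rintro rfl
      simp at hl
    rw [List.toFinset_cons, lmarginal_insert _ hmeas hi']
    simp only [lmarginal_eq_iterInt hg he hb t L hnd, hsum]
    have hint := iterInt_comp_intervalIntegrable hg (L := L.map fun i => (e i, b i))
      (by simp [he]) (he i) (t + ∑ l ∈ ((i :: L).toFinset)ᶜ, e l * x l) 0 (b i)
    rw [intervalIntegrable_iff_integrableOn_Icc_of_le (hb i)] at hint
    rw [← ofReal_integral_eq_lintegral_ofReal hint (Eventually.of_forall fun y =>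
        iterInt_nonneg hg _ (by simp [hb]) _), integral_Icc_eq_integral_Ioc,
      ← intervalIntegral.integral_of_le (hb i)]
    simp [iterInt]

theorem setIntegral_pi_Icc_eq_iterInt [Fintype ι] (hg : PeriodicDensity g)
    (he : ∀ i, e i ≠ 0) {b : ι → ℝ} (hb : ∀ i, 0 ≤ b i) (t : ℝ) {L : List ι} (hnd : L.Nodup)
    (hL : ∀ i, i ∈ L) :
    ∫ v in Set.univ.pi (fun i => Icc (0:ℝ) (b i)), g (t + ∑ i, e i * v i)
      = iterInt g (L.map fun i => (e i, b i)) t := by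
  classical
  have huniv : L.toFinset = Finset.univ := by ext; simp [hL]
  have h := lmarginal_eq_iterInt hg he hb t L hnd 0
  rw [huniv, lmarginal_univ] at h
  beta_reduce at h
  rw [volume_pi, Measure.restrict_pi_pi, integral_eq_lintegral_of_nonneg_ae
    (Eventually.of_forall fun v => hg.nonneg _)
    (hg.measurable.comp (by fun_prop)).aestronglyMeasurable, h]
  simp [iterInt_nonneg hg (L.map fun i => (e i, b i)) (by simp [hb])]

end iterInt

section signature

variable {ι : Type*} [Fintype ι] [DecidableEq ι] {g : ℝ → ℝ} {e : ι → ℝ} {N : ℝ}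
  {C : (ι → ℝ) → ℝ}

theorem deriv_boxIntegral (hg : PeriodicDensity g) (he : ∀ i, e i ≠ 0)
    (hC : ∀ u : ι → ℝ, C u = ∫ v in Set.univ.pi (fun i => Icc (0:ℝ) (u i)),
      g (N + ∑ i, e i * v i))
    {k : ι} {L : List ι} (hL : L ≠ []) (hnd : (k :: L).Nodup) (hmem : ∀ i, i ∈ k :: L)
    {w : ι → ℝ} (hw : ∀ i, 0 ≤ w i) (hk : 0 < w k) :
    deriv (fun x => C (Function.update w k x)) (w k)
      = iterInt g (L.map fun i => (e i, w i)) (N + e k * w k) := by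
  have hkL : k ∉ L := (List.nodup_cons.1 hnd).1
  refine HasDerivAt.deriv ((hasDerivAt_iterInt_bound hg (by simpa using hL) (by simp [he])
    (e k) N (w k)).congr_of_eventuallyEq ?_)
  filter_upwards [lt_mem_nhds hk] with x hx
  have hb : ∀ i, 0 ≤ Function.update w k x i := fun i => by
    by_cases h : i = k
    · subst h; simpa using hx.le
    · simpa [h] using hw i
  rw [hC, setIntegral_pi_Icc_eq_iterInt hg he hb N hnd hmem, List.map_cons, Function.update_self]
  congr 2
  refine List.map_congr_left fun i hi => ?_
  rw [Function.update_of_ne]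
  rintro rfl
  exact hkL hi

theorem deriv_boxIntegral_update_eventuallyEq (hg : PeriodicDensity g) (he : ∀ i, e i ≠ 0)
    (hC : ∀ u : ι → ℝ, C u = ∫ v in Set.univ.pi (fun i => Icc (0:ℝ) (u i)),
      g (N + ∑ i, e i * v i))
    {P : ι → (ι → ℝ) → ℝ}
    (hP : ∀ k u, P k u = deriv (fun x : ℝ => C (Function.update u k x)) (u k))
    {k : ι} {L : List ι} (hL : L ≠ []) (hnd : (k :: L).Nodup) (hmem : ∀ i, i ∈ k :: L)
    {u : ι → ℝ} (hu : ∀ i, 0 ≤ u i) (hk : 0 < u k) {j : ι} (hj : 0 < u j) :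
    (fun x => P k (Function.update u j x)) =ᶠ[𝓝 (u j)] fun x =>
      iterInt g (L.map fun i => (e i, Function.update u j x i))
        (N + e k * Function.update u j x k) := by
  filter_upwards [lt_mem_nhds hj] with x hx
  rw [hP]
  refine deriv_boxIntegral hg he hC hL hnd hmem (fun i => ?_) ?_
  · by_cases h : i = j
    · subst h; simpa using hx.le
    · simpa [h] using hu i
  · by_cases h : k = j
    · subst h; simpa using hx
    · simpa [h] using hk

end signature

end

theorem stmt_18 (d : ℕ) (hd : 3 ≤ d) (s : Fin d → Bool) (f : ℝ → ℝ) (hf : IsGenerator f)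
    (c : (Fin d → ℝ) → ℝ)
    (hc : ∀ u : Fin d → ℝ, c u = f (Int.fract (∑ k : Fin d, if s k then 1 - u k else u k)))
    (C : (Fin d → ℝ) → ℝ)
    (hC : ∀ u : Fin d → ℝ, C u = ∫ v in Set.univ.pi (fun j : Fin d => Set.Icc (0:ℝ) (u j)), c v)
    -- `P k u` is the first-order partial derivative `∂ₖ C(u)`
    (P : Fin d → (Fin d → ℝ) → ℝ)
    (hP : ∀ (k : Fin d) (u : Fin d → ℝ),
      P k u = deriv (fun x : ℝ => C (Function.update u k x)) (u k)) :
    ∀ j k : Fin d, ∃ D2 : (Fin d → ℝ) → ℝ,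
      -- `∂ⱼ∂ₖ C` exists on `Vⱼ ∩ Vₖ` and equals `D2`
      (∀ u : Fin d → ℝ,
        (∀ l, u l ∈ Set.Icc (0:ℝ) 1) → 0 < u j → u j < 1 → 0 < u k → u k < 1 →
        HasDerivAt (fun x : ℝ => P k (Function.update u j x)) (D2 u) (u j))
      -- `∂ⱼ∂ₖ C` is continuous on `Vⱼ ∩ Vₖ`
      ∧ ContinuousOn D2
          {u : Fin d → ℝ | (∀ l, u l ∈ Set.Icc (0:ℝ) 1)
            ∧ 0 < u j ∧ u j < 1 ∧ 0 < u k ∧ u k < 1}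
      -- `|∂ⱼ∂ₖ C| ≤ 1` there
      ∧ (∀ u : Fin d → ℝ,
          (∀ l, u l ∈ Set.Icc (0:ℝ) 1) → 0 < u j → u j < 1 → 0 < u k → u k < 1 →
          |D2 u| ≤ 1)
      -- for `j ≠ k`, the explicit formula, with values in `[0,1]`
      ∧ (j ≠ k → ∀ u : Fin d → ℝ,
          (∀ l, u l ∈ Set.Icc (0:ℝ) 1) → 0 < u j → u j < 1 → 0 < u k → u k < 1 →
          D2 u ∈ Set.Icc (0:ℝ) 1 ∧
          D2 u = ∫ w in Set.univ.pi
              (fun l : {l : Fin d // l ≠ j ∧ l ≠ k} => Set.Icc (0:ℝ) (u l.1)),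
            c (fun l : Fin d =>
              if h1 : l = j then u j else if h2 : l = k then u k else w ⟨l, h1, h2⟩)) := by
  classical
  set g : ℝ → ℝ := fun t => f (Int.fract t) with hgdef
  have hg : PeriodicDensity g := hf.periodicDensity
  set e : Fin d → ℝ := fun i => if s i then -1 else 1 with hedef
  set N : ℝ := ∑ i : Fin d, if s i then (1:ℝ) else 0 with hN
  have he1 : ∀ i, e i = 1 ∨ e i = -1 := fun i => by
    by_cases h : s i <;> simp [hedef, h]
  have he : ∀ i, e i ≠ 0 := fun i => by rcases he1 i with h | h <;> simp [h]
  have hcg : ∀ u : Fin d → ℝ, c u = g (N + ∑ i, e i * u i) := fun u => by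
    rw [hc, hgdef, hN, ← Finset.sum_add_distrib]
    congr 2
    refine Finset.sum_congr rfl fun i _ => ?_
    by_cases h : s i <;> simp [hedef, h, sub_eq_add_neg]
  have hCg : ∀ u : Fin d → ℝ, C u = ∫ v in Set.univ.pi (fun i => Set.Icc (0:ℝ) (u i)),
      g (N + ∑ i, e i * v i) := fun u => by simp only [hC, hcg]
  -- an enumeration of the coordinates other than `j` and `k`
  have hrest : ∀ j k : Fin d, ∃ M : List {l : Fin d // l ≠ j ∧ l ≠ k},
      M ≠ [] ∧ M.Nodup ∧ ∀ l, l ∈ M := fun j k => by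
    refine ⟨Finset.univ.toList, ?_, Finset.nodup_toList _, fun l => by simp⟩
    obtain ⟨l, hl⟩ : ∃ l, l ∉ ({j, k} : Finset (Fin d)) := by
      by_contra! h
      have h1 := Finset.card_le_two (a := j) (b := k)
      rw [Finset.eq_univ_iff_forall.2 h, Finset.card_univ, Fintype.card_fin] at h1
      omega
    simp only [Finset.mem_insert, Finset.mem_singleton, not_or] at hl
    exact List.ne_nil_of_mem (Finset.mem_toList.2 (Finset.mem_univ ⟨l, hl⟩))
  have hcons : ∀ {j k : Fin d}, j ≠ k → ∀ {M : List {l : Fin d // l ≠ j ∧ l ≠ k}},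
      M.Nodup → (∀ l, l ∈ M) → (k :: j :: M.map Subtype.val).Nodup ∧
        ∀ i, i ∈ k :: j :: M.map Subtype.val := fun {j k} hjk M hnd hmem => by
    refine ⟨?_, fun i => ?_⟩
    · simp only [List.nodup_cons, List.mem_cons, List.mem_map, not_or]
      refine ⟨⟨hjk.symm, ?_⟩, ?_, hnd.map Subtype.val_injective⟩
      · rintro ⟨x, _, hx⟩
        exact x.2.2 hx
      · rintro ⟨x, _, hx⟩
        exact x.2.1 hx
    · by_cases h2 : i = k
      · simp [h2]
      by_cases h1 : i = j
      · simp [h1]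
      simp [h1, h2, hmem]
  have hbound : ∀ (L : List (Fin d)), L ≠ [] → ∀ u : Fin d → ℝ, (∀ l, u l ∈ Set.Icc (0:ℝ) 1) →
      ∀ t, iterInt g (L.map fun i => (e i, u i)) t ∈ Set.Icc (0:ℝ) 1 := fun L hL u hu t =>
    ⟨iterInt_nonneg hg _ (by simpa using fun i _ => (hu i).1) t,
      iterInt_le_one hg _ (by simpa using hL) (by simpa using fun i _ => ⟨he1 i, hu i⟩) t⟩
  intro j k
  by_cases hjk : j = k
  · subst hjk
    obtain ⟨m, hm⟩ : ∃ m, m ≠ j := by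
      obtain ⟨M, hM, -, -⟩ := hrest j j
      obtain ⟨l, -⟩ := List.exists_mem_of_ne_nil M hM
      exact ⟨l.1, l.2.1⟩
    obtain ⟨M, hM, hnd, hmem⟩ := hrest m j
    obtain ⟨hnd', hmem'⟩ := hcons hm hnd hmem
    set L := M.map Subtype.val with hLdef
    have hL : L ≠ [] := mt List.map_eq_nil_iff.1 hM
    have hcont := continuous_iterInt hg he L hL
    refine ⟨fun u => (e m)⁻¹ * (iterInt g (L.map fun i => (e i, u i)) (N + e j * u j + e m * u m)
      - iterInt g (L.map fun i => (e i, u i)) (N + e j * u j)) * e j, ?_, ?_, ?_,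
      fun h => absurd rfl h⟩
    · intro u hu hj _ _ _
      refine HasDerivAt.congr_of_eventuallyEq ?_ (deriv_boxIntegral_update_eventuallyEq hg he hCg hP
        (List.cons_ne_nil _ _) hnd' hmem' (fun i => (hu i).1) hj hj)
      have h1 : ∀ x, (m :: L).map (fun i => (e i, Function.update u j x i))
          = (m :: L).map fun i => (e i, u i) := fun x => by
        refine List.map_congr_left fun i hi => ?_
        rw [Function.update_of_ne]
        rintro rfl
        exact (List.nodup_cons.1 hnd').1 hi
      simp only [h1, Function.update_self]
      have hlin : HasDerivAt (fun x : ℝ => N + e j * x) (e j) (u j) := by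
        simpa using ((hasDerivAt_id (u j)).const_mul (e j)).const_add N
      exact (hasDerivAt_iterInt hg (L := L.map fun i => (e i, u i)) (by simpa using hL)
        (by simp [he]) (he m) (u m)
        (N + e j * u j)).comp (u j) hlin
    · refine Continuous.continuousOn ?_
      refine (continuous_const.mul (Continuous.sub ?_ ?_)).mul continuous_const
      · exact hcont.comp (f := fun u : Fin d → ℝ => (u, N + e j * u j + e m * u m)) (by fun_prop)
      · exact hcont.comp (f := fun u : Fin d → ℝ => (u, N + e j * u j)) (by fun_prop)
    · intro u hu _ _ _ _
      have habs : ∀ i, |e i| = 1 := fun i => by rcases he1 i with h | h <;> simp [h]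
      have h1 := hbound L hL u hu (N + e j * u j + e m * u m)
      have h2 := hbound L hL u hu (N + e j * u j)
      rw [abs_mul, abs_mul, abs_inv, habs, habs, inv_one, one_mul, mul_one, abs_le]
      constructor <;> linarith [h1.1, h1.2, h2.1, h2.2]
  · obtain ⟨M, hM, hnd, hmem⟩ := hrest j k
    obtain ⟨hnd', hmem'⟩ := hcons hjk hnd hmem
    have hkj : k ≠ j := Ne.symm hjk
    set L := M.map Subtype.val with hLdef
    have hL : L ≠ [] := mt List.map_eq_nil_iff.1 hM
    refine ⟨fun u => iterInt g (L.map fun i => (e i, u i)) (N + e k * u k + e j * u j),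
      ?_, ?_, ?_, ?_⟩
    · intro u hu hj _ hk _
      refine HasDerivAt.congr_of_eventuallyEq ?_ (deriv_boxIntegral_update_eventuallyEq hg he hCg hP
        (List.cons_ne_nil _ _) hnd' hmem' (fun i => (hu i).1) hk hj)
      have h1 : ∀ x, L.map (fun i => (e i, Function.update u j x i))
          = L.map fun i => (e i, u i) := fun x => by
        refine List.map_congr_left fun i hi => ?_
        rw [Function.update_of_ne]
        rintro rfl
        exact (List.nodup_cons.1 (List.nodup_cons.1 hnd').2).1 hi
      simp only [List.map_cons, h1, Function.update_self, Function.update_of_ne hkj]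
      exact hasDerivAt_iterInt_bound hg (by simpa using hL) (by simp [he]) (e j) (N + e k * u k)
        (u j)
    · exact ((continuous_iterInt hg he L hL).comp
        (f := fun u : Fin d → ℝ => (u, N + e k * u k + e j * u j)) (by fun_prop)).continuousOn
    · intro u hu _ _ _ _
      have h := hbound L hL u hu (N + e k * u k + e j * u j)
      exact abs_le.2 ⟨by linarith [h.1], h.2⟩
    · intro _ u hu _ _ _ _
      refine ⟨hbound L hL u hu _, ?_⟩
      have hbox := setIntegral_pi_Icc_eq_iterInt hg
        (e := fun l : {l : Fin d // l ≠ j ∧ l ≠ k} => e l) (fun l => he l)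
        (b := fun l => u l) (fun l => (hu l).1) (N + e k * u k + e j * u j) hnd hmem
      simp only [hLdef, List.map_map, Function.comp_def]
      rw [← hbox]
      refine integral_congr_ae (Filter.Eventually.of_forall fun w => ?_)
      set v : Fin d → ℝ := fun l =>
        if h1 : l = j then u j else if h2 : l = k then u k else w ⟨l, h1, h2⟩ with hv
      change g (N + e k * u k + e j * u j + ∑ l : {l : Fin d // l ≠ j ∧ l ≠ k}, e l * w l) = c v
      rw [hcg]
      congr 1
      have hvj : v j = u j := by simp [hv]
      have hvk : v k = u k := by simp [hv, hkj]
      have hvw : ∀ l : {l : Fin d // l ≠ j ∧ l ≠ k}, v l = w l := fun l => by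
        simp [hv, l.2.1, l.2.2]
      have hS : ∑ l : {l : Fin d // l ≠ j ∧ l ≠ k}, e l * w l
          = ∑ i ∈ (Finset.univ.erase k).erase j, e i * v i := by
        simp only [← hvw]
        refine (Finset.sum_subtype _ (fun i => ?_) fun i => e i * v i).symm
        simp
      rw [hS, ← Finset.add_sum_erase _ _ (Finset.mem_univ k),
        ← Finset.add_sum_erase (Finset.univ.erase k) _ (Finset.mem_erase.2 ⟨hjk, Finset.mem_univ j⟩),
        hvj, hvk]
      ring
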